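/- Let G be a 3-connected simple graph, let u and v be distinct vertices of G, and let e_u be an edge of G with endpoints u and u'. Then there exist three pairwise internally vertex-disjoint paths P₁, P₂, P₃ from u to v such that e_u is an edge of one of the three paths. -/

import Mathlib

open SimpleGraph

/-- Two `u`–`v` walks are internally vertex-disjoint if every vertex they have in
common is `u` or `v`. -/
def InternallyDisjoint {V : Type*} {G : SimpleGraph V} {u v : V}
    (p q : G.Walk u v) : Prop :=
  ∀ w, w ∈ p.support → w ∈ q.support → w = u ∨ w = v

/-- A finite simple graph is 3-connected if it has at least 4 vertices and deleting
any set of at most 2 vertices leaves a connected graph. -/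
def ThreeConnected {V : Type*} [Fintype V] (G : SimpleGraph V) : Prop :=
  4 ≤ Fintype.card V ∧
    ∀ S : Set V, S.ncard ≤ 2 → (G.induce Sᶜ).Connected

namespace SimpleGraph

variable {V : Type*} {G H : SimpleGraph V}

/-- A set `S` separates `A` from `B` if every walk from `A` to `B` meets `S`. -/
def Separates (G : SimpleGraph V) (A B S : Set V) : Prop :=
  ∀ ⦃a b : V⦄, a ∈ A → b ∈ B → ∀ w : G.Walk a b, ∃ s ∈ S, s ∈ w.support

/-- A family of `k` pairwise vertex-disjoint paths from `A` to `B`. -/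
def HasLinkage (G : SimpleGraph V) (A B : Set V) (k : ℕ) : Prop :=
  ∃ (a b : Fin k → V) (w : ∀ i, G.Walk (a i) (b i)),
    (∀ i, a i ∈ A) ∧ (∀ i, b i ∈ B) ∧ (∀ i, (w i).IsPath) ∧
      ∀ i j z, z ∈ (w i).support → z ∈ (w j).support → i = j

lemma Separates.symm {A B S : Set V} (h : G.Separates A B S) : G.Separates B A S := by
  intro b a hb ha w
  simpa using h ha hb w.reverse

/-- A walk that meets `X` contains a path from its start to a vertex of `X` with no earlier
vertex in `X`. -/
lemma Walk.exists_isPath_first_mem (X : Set V) {a b : V} (w : G.Walk a b)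
    (h : ∃ s ∈ X, s ∈ w.support) :
    ∃ (x : V) (r : G.Walk a x), x ∈ X ∧ r.IsPath ∧ r.support ⊆ w.support ∧
      ∀ z ∈ r.support, z ∈ X → z = x := by
  classical
  induction w with
  | nil =>
    obtain ⟨s, hs, hs'⟩ := h
    simp only [Walk.support_nil, List.mem_singleton] at hs'
    subst hs'
    exact ⟨_, .nil, hs, .nil, by simp, by simp⟩
  | @cons a c b hac w ih =>
    by_cases ha : a ∈ X
    · exact ⟨a, .nil, ha, .nil, by simp, by simp⟩
    obtain ⟨s, hs, hs'⟩ := h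
    have hsw : s ∈ w.support := by
      rw [Walk.support_cons, List.mem_cons] at hs'
      exact hs'.resolve_left fun h => ha (h ▸ hs)
    obtain ⟨x, r, hx, -, hr, hfirst⟩ := ih ⟨s, hs, hsw⟩
    refine ⟨x, (Walk.cons hac r).bypass, hx, Walk.bypass_isPath _, ?_, ?_⟩
    · intro z hz
      have := Walk.support_bypass_subset_support _ hz
      rw [Walk.support_cons, List.mem_cons] at this ⊢
      exact this.imp_right fun h => hr h
    · intro z hz hzX
      have := Walk.support_bypass_subset_support _ hz
      rw [Walk.support_cons, List.mem_cons] at this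
      rcases this with rfl | h
      · exact absurd hzX ha
      · exact hfirst z h hzX

lemma Walk.exists_deleteEdges_of_notMem_edges {e : Sym2 V} {a b : V} (w : G.Walk a b)
    (h : e ∉ w.edges) : ∃ r : (G.deleteEdges {e}).Walk a b, r.support = w.support :=
  ⟨w.toDeleteEdge e h, by simp [Walk.toDeleteEdge]⟩

/-- Splitting a walk at an edge that is to be deleted. -/
lemma Walk.exists_deleteEdges_or_split (e : Sym2 V) {a b : V} (w : G.Walk a b) :
    (∃ r : (G.deleteEdges {e}).Walk a b, r.support ⊆ w.support) ∨
      ∃ (x y : V) (r : (G.deleteEdges {e}).Walk a x) (t : (G.deleteEdges {e}).Walk b y),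
        e = s(x, y) ∧ r.support ⊆ w.support ∧ t.support ⊆ w.support := by
  induction w with
  | nil => exact .inl ⟨.nil, by simp⟩
  | @cons a c b hac w ih =>
    have hsub : w.support ⊆ (Walk.cons hac w).support := by simp
    by_cases he : e = s(a, c)
    · rcases ih with ⟨r, hr⟩ | ⟨x, y, r, t, hxy, hr, ht⟩
      · exact .inr ⟨a, c, .nil, r.reverse, he, by simp,
          fun z hz => hsub (hr (by simpa using hz))⟩
      · rw [he, Sym2.eq_iff] at hxy
        rcases hxy with ⟨rfl, rfl⟩ | ⟨rfl, rfl⟩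
        · exact .inr ⟨a, c, .nil, t, he, by simp, fun z hz => hsub (ht hz)⟩
        · exact .inl ⟨t.reverse, fun z hz => hsub (ht (by simpa using hz))⟩
    · have hadj : (G.deleteEdges {e}).Adj a c := by
        simp only [deleteEdges_adj, Set.mem_singleton_iff]
        exact ⟨hac, fun h => he h.symm⟩
      rcases ih with ⟨r, hr⟩ | ⟨x, y, r, t, hxy, hr, ht⟩
      · exact .inl ⟨.cons hadj r, by simpa using List.cons_subset_cons a hr⟩
      · exact .inr ⟨x, y, .cons hadj r, t, hxy, by simpa using List.cons_subset_cons a hr,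
          fun z hz => hsub (ht hz)⟩

lemma Separates.of_deleteEdges {A B S T : Set V} {e : Sym2 V} {x y b : V} (he : e = s(x, y))
    (hxy : x ≠ y) (hS : (G.deleteEdges {e}).Separates A B S) (hx : x ∉ S) (hb : b ∈ B)
    (t : (G.deleteEdges {e}).Walk b y) (ht : ∀ z ∈ t.support, z ∉ S)
    (hT : (G.deleteEdges {e}).Separates A (insert x S) T) : G.Separates A B T := by
  classical
  intro a b' ha hb' w
  have hxe : ∀ {c d : V} (r : G.Walk c d), x ∉ r.support → e ∉ r.edges := fun r hx h =>
    hx (r.fst_mem_support_of_mem_edges (he ▸ h))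
  have hmeet : ∃ s ∈ insert x S, s ∈ w.support := by
    by_contra! hno
    obtain ⟨r, hr⟩ := w.exists_deleteEdges_of_notMem_edges 
      (hxe w (hno x (by simp)))
    obtain ⟨s, hs, hsr⟩ := hS ha hb' r
    exact hno s (by simp [hs]) (hr ▸ hsr)
  obtain ⟨p, r, hp, hrp, hrw, hfirst⟩ := w.exists_isPath_first_mem _ hmeet
  have her : e ∉ r.edges := by
    intro h
    rw [he] at h
    obtain rfl := hfirst x (r.fst_mem_support_of_mem_edges h) (by simp)
    have hy := r.snd_mem_support_of_mem_edges h
    have hx' := Walk.endpoint_notMem_support_takeUntil hrp hy hxy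
    obtain ⟨q, hq⟩ := (r.takeUntil y hy).exists_deleteEdges_of_notMem_edges (hxe _ hx')
    obtain ⟨s, hs, hsq⟩ := hS ha hb (q.append t.reverse)
    rw [Walk.mem_support_append_iff, Walk.support_reverse, List.mem_reverse, hq] at hsq
    rcases hsq with hsq | hsq
    · have := hfirst s (r.support_takeUntil_subset_support hy hsq) (by simp [hs])
      exact hx (this ▸ hs)
    · exact ht s hsq hs
  obtain ⟨q, hq⟩ := r.exists_deleteEdges_of_notMem_edges her
  obtain ⟨s, hs, hsq⟩ := hT ha hp q
  exact ⟨s, hs, hrw (hq ▸ hsq)⟩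

lemma HasLinkage.mono {A B : Set V} {k : ℕ} (hle : H ≤ G) (h : H.HasLinkage A B k) :
    G.HasLinkage A B k := by
  obtain ⟨a, b, w, ha, hb, hw, hd⟩ := h
  exact ⟨a, b, fun i => (w i).mapLe hle, ha, hb, fun i => (hw i).mapLe hle,
    by simpa using hd⟩

lemma Separates.mem_of_isPath {A B S : Set V} {x y a p b q z : V} (hS : H.Separates A B S)
    (ha : a ∈ A) (hb : b ∈ B) {w : H.Walk a p} {t : H.Walk b q} (hw : w.IsPath) (ht : t.IsPath)
    (hwS : ∀ s ∈ w.support, s ∈ insert x S → s = p)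
    (htS : ∀ s ∈ t.support, s ∈ insert y S → s = q)
    (hzw : z ∈ w.support) (hzt : z ∈ t.support) : z ∈ S := by
  classical
  by_contra hz
  have key : ∀ {a p : V} {x : V} {w : H.Walk a p}, w.IsPath →
      (∀ s ∈ w.support, s ∈ insert x S → s = p) → ∀ hzw : z ∈ w.support,
      ∀ s ∈ (w.takeUntil z hzw).support, s ∉ S := by
    intro a p x w hw hwS hzw s hs hsS
    obtain rfl := hwS s (w.support_takeUntil_subset_support hzw hs) (by simp [hsS])
    exact Walk.endpoint_notMem_support_takeUntil hw hzw (fun h => hz (h ▸ hsS)) hs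
  obtain ⟨s, hs, hs'⟩ := hS ha hb ((w.takeUntil z hzw).append (t.takeUntil z hzt).reverse)
  rw [Walk.mem_support_append_iff, Walk.support_reverse, List.mem_reverse] at hs'
  rcases hs' with h | h
  · exact key hw hwS hzw s h hs
  · exact key ht htS hzt s h hs

/-- The ends of a linkage of size `k` into a set of at most `k` vertices cover that set, and
the paths of the linkage meet the set only in their ends. -/
lemma ends_of_linkage [DecidableEq V] {k : ℕ} {P : Finset V} (hP : P.card ≤ k) {a p : Fin k → V}
    {w : ∀ i, G.Walk (a i) (p i)} (hp : ∀ i, p i ∈ P)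
    (hd : ∀ i j z, z ∈ (w i).support → z ∈ (w j).support → i = j) :
    (∀ z ∈ P, ∃ i, p i = z) ∧ ∀ i, ∀ z ∈ (w i).support, z ∈ P → z = p i := by
  have hinj : Function.Injective p := fun i j h =>
    hd i j (p i) (Walk.end_mem_support _) (by rw [h]; exact Walk.end_mem_support _)
  have himg : Finset.univ.image p = P := by
    apply Finset.eq_of_subset_of_card_le
    · intro z hz
      obtain ⟨i, -, rfl⟩ := Finset.mem_image.1 hz
      exact hp i
    · rw [Finset.card_image_of_injective _ hinj]
      simpa using hP
  have hsurj : ∀ z ∈ P, ∃ i, p i = z := by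
    intro z hz
    rw [← himg] at hz
    simpa using hz
  refine ⟨hsurj, fun i z hz hzP => ?_⟩
  obtain ⟨j, rfl⟩ := hsurj z hzP
  rw [hd i j _ hz (Walk.end_mem_support _)]

lemma HasLinkage.glue [DecidableEq V] {A B : Set V} {S : Finset V} {k : ℕ} {x y : V}
    (hle : H ≤ G) (hxy : G.Adj x y)
    (hS : H.Separates A B S) (hy : y ∉ S) (hcard : S.card < k)
    (hA : H.HasLinkage A (insert x S : Finset V) k)
    (hB : H.HasLinkage B (insert y S : Finset V) k) : G.HasLinkage A B k := by
  obtain ⟨a, p, w, ha, hp, hw, hwd⟩ := hA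
  obtain ⟨b, q, t, hb, hq, ht, htd⟩ := hB
  have hcx : (insert x S).card ≤ k := (Finset.card_insert_le _ _).trans hcard
  have hcy : (insert y S).card ≤ k := (Finset.card_insert_le _ _).trans hcard
  obtain ⟨-, hwP⟩ := ends_of_linkage hcx hp hwd
  obtain ⟨hqs, htQ⟩ := ends_of_linkage hcy hq htd
  have hσ : ∀ i, ∃ j, q j = if p i = x then y else p i := by
    intro i
    apply hqs
    split_ifs with h
    · simp
    · have := hp i
      simp only [Finset.coe_insert, Set.mem_insert_iff, h, false_or] at this
      exact Finset.mem_insert_of_mem this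
  choose σ hσ using hσ
  have hpinj : Function.Injective p := fun i j h =>
    hwd i j (p i) (Walk.end_mem_support _) (by rw [h]; exact Walk.end_mem_support _)
  have hcross : ∀ i j z, z ∈ (w i).support → z ∈ (t (σ j)).support → i = j := by
    intro i j z hzi hzj
    have hzS : z ∈ S := hS.mem_of_isPath (x := x) (y := y) (ha i) (hb _) (hw i) (ht _)
      (fun s hs hs' => hwP i s hs (by simpa using hs'))
      (fun s hs hs' => htQ _ s hs (by simpa using hs')) hzi hzj
    have h1 := hwP i z hzi (by simp [hzS])
    have h2 := htQ _ z hzj (by simp [hzS])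
    rw [hσ] at h2
    split_ifs at h2 with h
    · exact absurd (h2 ▸ hzS) hy
    · exact hpinj (h1.symm.trans h2)
  have hσinj : ∀ i j, σ i = σ j → i = j := by
    intro i j h
    have h1 := hσ i
    rw [h, hσ j] at h1
    have hpy : ∀ i, p i ≠ x → p i ≠ y := fun i hi hiy => by
      have := hp i
      simp only [Finset.coe_insert, Set.mem_insert_iff, hi, false_or] at this
      exact hy (hiy ▸ this)
    apply hpinj
    split_ifs at h1 with h2 h3 h3
    · rw [h2, h3]
    · exact absurd h1.symm (hpy i h3)
    · exact absurd h1 (hpy j h2)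
    · exact h1.symm
  have hjoin : ∀ i, ∃ r : G.Walk (a i) (b (σ i)), r.IsPath ∧
      ∀ z ∈ r.support, z ∈ (w i).support ∨ z ∈ (t (σ i)).support := by
    intro i
    obtain ⟨r, hr⟩ : ∃ r : G.Walk (p i) (q (σ i)),
        ∀ z ∈ r.support, z = p i ∨ z = q (σ i) := by
      by_cases h : p i = x
      · have hadj : G.Adj (p i) (q (σ i)) := by rwa [hσ, if_pos h, h]
        exact ⟨hadj.toWalk, by simp⟩
      · have heq : p i = q (σ i) := by rw [hσ, if_neg h]
        exact ⟨Walk.nil.copy rfl heq, by simp⟩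
    refine ⟨((((w i).mapLe hle).append r).append ((t (σ i)).mapLe hle).reverse).bypass,
      Walk.bypass_isPath _, fun z hz => ?_⟩
    have := Walk.support_bypass_subset_support _ hz
    simp only [Walk.mem_support_append_iff, Walk.support_reverse, List.mem_reverse,
      Walk.support_mapLe_eq_support] at this
    rcases this with (h | h) | h
    · exact .inl h
    · rcases hr z h with rfl | rfl
      · exact .inl (Walk.end_mem_support _)
      · exact .inr (Walk.end_mem_support _)
    · exact .inr h
  choose r hr hrs using hjoin
  refine ⟨a, fun i => b (σ i), r, ha, fun i => hb _, hr, fun i j z hi hj => ?_⟩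
  rcases hrs i z hi with h1 | h1 <;> rcases hrs j z hj with h2 | h2
  · exact hwd i j z h1 h2
  · exact hcross i j z h1 h2
  · exact (hcross j i z h2 h1).symm
  · exact hσinj i j (htd _ _ z h1 h2)

/-- **Menger's theorem** for two sets of vertices of a finite graph. -/
theorem hasLinkage_of_separates [Finite V] (G : SimpleGraph V) (A B : Set V) (k : ℕ)
    (h : ∀ S : Finset V, G.Separates A B S → k ≤ S.card) : G.HasLinkage A B k := by
  classical
  have := Fintype.ofFinite V
  induction G using WellFoundedLT.induction generalizing A B with
  | ind G ih =>
    by_cases hG : G = ⊥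
    · subst hG
      have hk : k ≤ (A ∩ B).toFinset.card := by
        apply h
        intro a b ha hb w
        cases w with
        | nil => exact ⟨a, by simp [ha, hb], by simp⟩
        | cons hadj _ => exact hadj.elim
      obtain ⟨f⟩ : Nonempty (Fin k ↪ (A ∩ B).toFinset) :=
        Function.Embedding.nonempty_of_card_le (by rwa [Fintype.card_fin, Fintype.card_coe])
      have hf : ∀ i, (f i : V) ∈ A ∩ B := fun i => Set.mem_toFinset.1 (f i).2
      refine ⟨fun i => f i, fun i => f i, fun i => .nil, fun i => (hf i).1, fun i => (hf i).2,
        fun i => .nil, fun i j z hi hj => ?_⟩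
      simp only [Walk.support_nil, List.mem_singleton] at hi hj
      exact f.injective (Subtype.ext (hi.symm.trans hj))
    obtain ⟨c, d, hcd⟩ := ne_bot_iff_exists_adj.1 hG
    have hle : G.deleteEdges {s(c, d)} ≤ G := deleteEdges_le _
    have hlt : G.deleteEdges {s(c, d)} < G := by
      refine lt_of_le_of_ne hle fun heq => ?_
      rw [← heq] at hcd
      simp at hcd
    by_cases hk : ∀ S : Finset V, (G.deleteEdges {s(c, d)}).Separates A B S → k ≤ S.card
    · exact (ih _ hlt A B hk).mono hle
    push Not at hk
    obtain ⟨S, hS, hSk⟩ := hk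
    have hnot : ¬ G.Separates A B S := fun h' => (h S h').not_gt hSk
    simp only [Separates] at hnot
    push Not at hnot
    obtain ⟨a, b, ha, hb, w, hw⟩ := hnot
    rcases w.exists_deleteEdges_or_split s(c, d) with ⟨r, hr⟩ | ⟨x, y, r, t, he, hr, ht⟩
    · obtain ⟨s, hs, hs'⟩ := hS ha hb r
      exact absurd (hr hs') (hw s hs)
    have hrS : ∀ z ∈ r.support, z ∉ (S : Set V) := fun z hz hzS => hw z hzS (hr hz)
    have htS : ∀ z ∈ t.support, z ∉ (S : Set V) := fun z hz hzS => hw z hzS (ht hz)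
    have hx := hrS x (Walk.end_mem_support _)
    have hy := htS y (Walk.end_mem_support _)
    have hxy : G.Adj x y := by rwa [← mem_edgeSet, ← he, mem_edgeSet]
    refine HasLinkage.glue hle hxy hS hy hSk (ih _ hlt _ _ ?_) (ih _ hlt _ _ ?_)
    · intro T hT
      refine h T (hS.of_deleteEdges he hxy.ne hx hb t htS ?_)
      simpa using hT
    · intro T hT
      refine h T (hS.symm.of_deleteEdges (he.trans Sym2.eq_swap) hxy.ne' hy ha r hrS ?_).symm
      simpa using hT


lemma _root_.ThreeConnected.exists_walk_avoiding [Fintype V] (hG : ThreeConnected G) {S : Set V}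
    (hS : S.ncard ≤ 2) {a b : V} (ha : a ∉ S) (hb : b ∉ S) :
    ∃ w : G.Walk a b, ∀ z ∈ w.support, z ∉ S := by
  obtain ⟨w⟩ : (G.induce Sᶜ).Reachable ⟨a, ha⟩ ⟨b, hb⟩ := (hG.2 S hS).preconnected _ _
  obtain ⟨r, hr⟩ : ∃ r : G.Walk a b, r.support = w.support.map (↑) :=
    ⟨w.map (Embedding.induce Sᶜ).toHom, Walk.support_map _ _⟩
  refine ⟨r, fun z hz => ?_⟩
  rw [hr, List.mem_map] at hz
  obtain ⟨z', -, rfl⟩ := hz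
  exact z'.2

/-- A path between nonadjacent vertices has an interior running between their neighbourhoods. -/
lemma Walk.IsPath.exists_interior {u v : V} {p : G.Walk u v} (hp : p.IsPath) (huv : u ≠ v)
    (hadj : ¬ G.Adj u v) :
    ∃ (a b : V) (w : (G.induce {u, v}ᶜ).spanningCoe.Walk a b), G.Adj u a ∧ G.Adj b v ∧
      w.support ⊆ p.support ∧ u ∉ w.support ∧ v ∉ w.support := by
  cases p with
  | nil => exact absurd rfl huv
  | @cons _ a _ hua q =>
    have hav : v ≠ a := by rintro rfl; exact hadj hua
    obtain ⟨hq, huq⟩ := (Walk.cons_isPath_iff _ _).1 hp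
    obtain ⟨r, hr⟩ : ∃ r : G.Walk v a, r = q.reverse := ⟨_, rfl⟩
    have hrp : r.IsPath := hr ▸ hq.reverse
    have hrs : ∀ z, z ∈ r.support ↔ z ∈ q.support := by simp [hr]
    clear hr
    cases r with
    | nil => exact absurd rfl hav
    | @cons _ b _ hvb t =>
      obtain ⟨ht, hvt⟩ := (Walk.cons_isPath_iff _ _).1 hrp
      have htq : ∀ z ∈ t.support, z ∈ q.support := fun z hz =>
        (hrs z).1 (by simp [hz])
      have hut : u ∉ t.support := fun h => huq (htq u h)
      have hmem : ∀ z ∈ t.support, z ∈ ({u, v}ᶜ : Set V) := by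
        rintro z hz (rfl | rfl)
        · exact hut hz
        · exact hvt hz
      have hH : ∀ e ∈ t.edges, e ∈ (G.induce {u, v}ᶜ).spanningCoe.edgeSet := by
        intro e he
        induction e with
        | _ c d =>
          exact (map_adj _ _ _ _).2 ⟨⟨c, hmem c (t.fst_mem_support_of_mem_edges he)⟩,
            ⟨d, hmem d (t.snd_mem_support_of_mem_edges he)⟩,
            t.adj_of_mem_edges he, rfl, rfl⟩
      refine ⟨a, b, (t.transfer _ hH).reverse, hua, hvb.symm, ?_, ?_, ?_⟩
      · intro z hz
        simp only [Walk.support_reverse, List.mem_reverse, Walk.support_transfer] at hz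
        simp [htq z hz]
      · simpa using hut
      · simpa using hvt

lemma notMem_support_of_spanningCoe_induce {S : Set V} {a b : V}
    (w : (G.induce S).spanningCoe.Walk a b) (ha : a ∈ S) : ∀ z ∈ w.support, z ∈ S := by
  induction w with
  | nil => simpa using ha
  | cons hac w ih =>
    obtain ⟨_, c, -, -, rfl⟩ := (map_adj _ _ _ _).1 hac
    intro z hz
    rw [Walk.support_cons, List.mem_cons] at hz
    rcases hz with rfl | hz
    · exact ha
    · exact ih c.2 z hz

lemma _root_.ThreeConnected.exists_three_paths [Fintype V] (hG : ThreeConnected G) {u v : V}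
    (huv : u ≠ v) (hadj : ¬ G.Adj u v) :
    ∃ P : Fin 3 → G.Walk u v, (∀ i, (P i).IsPath) ∧
      ∀ i j, i ≠ j → InternallyDisjoint (P i) (P j) := by
  classical
  obtain ⟨a, b, w, ha, hb, hw, hd⟩ := hasLinkage_of_separates (G.induce {u, v}ᶜ).spanningCoe
    (G.neighborSet u) (G.neighborSet v) 3 (by
      intro S hS
      by_contra! hcard
      obtain ⟨w, hw⟩ := hG.exists_walk_avoiding (S := (S : Set V) \ {u, v}) (a := u) (b := v)
        ((Set.ncard_le_ncard Set.sdiff_subset).trans (by rw [Set.ncard_coe_finset]; omega))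
        (by simp) (by simp)
      obtain ⟨a, b, t, ha, hb, ht, hut, hvt⟩ := (w.bypass_isPath).exists_interior huv hadj
      obtain ⟨s, hs, hst⟩ := hS ha hb.symm t
      refine hw s (w.support_bypass_subset_support (ht hst)) ⟨hs, ?_⟩
      rintro (rfl | rfl)
      · exact hut hst
      · exact hvt hst)
  have hua : ∀ i, G.Adj u (a i) := ha
  have hvb : ∀ i, G.Adj v (b i) := hb
  have hle : (G.induce {u, v}ᶜ).spanningCoe ≤ G := spanningCoe_induce_le _ _
  have hmem : ∀ i, ∀ z ∈ (w i).support, z ∈ ({u, v}ᶜ : Set V) := fun i =>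
    notMem_support_of_spanningCoe_induce (w i) (by
      rintro (h | h)
      · exact (hua i).ne h.symm
      · exact hadj (h ▸ hua i))
  refine ⟨fun i => .cons (hua i) (((w i).mapLe hle).concat (hvb i).symm), fun i => ?_,
    fun i j hij z hi hj => ?_⟩
  · rw [Walk.cons_isPath_iff, Walk.concat_isPath_iff]
    refine ⟨⟨(hw i).mapLe hle, fun h => ?_⟩, fun h => ?_⟩
    · exact hmem i v (by simpa using h) (by simp)
    · rw [Walk.support_concat, List.mem_append, List.mem_singleton] at h
      exact h.elim (fun h => hmem i u (by simpa using h) (by simp)) huv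
  · simp only [Walk.support_cons, Walk.support_concat, List.mem_cons,
      List.mem_append, Walk.support_mapLe_eq_support, List.not_mem_nil, or_false] at hi hj
    rcases hi with h | hi | h
    · exact .inl h
    · rcases hj with h | hj | h
      · exact .inl h
      · exact absurd (hd i j z hi hj) hij
      · exact .inr h
    · exact .inr h

/-- One path of an internally disjoint family can be rerouted through a prescribed first edge. -/
lemma exists_reroute {ι : Type*} {u u' v : V} {P : ι → G.Walk u v} (i₀ : ι)
    (hP : ∀ i, (P i).IsPath)
    (hd : ∀ i j, i ≠ j → InternallyDisjoint (P i) (P j)) (heu : G.Adj u u')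
    (q : G.Walk u' v) (hq : u ∉ q.support) :
    ∃ (i : ι) (R : G.Walk u v), R.IsPath ∧ s(u, u') ∈ R.edges ∧
      ∀ j, j ≠ i → InternallyDisjoint R (P j) := by
  classical
  obtain ⟨x, r, ⟨i, hxi⟩, -, hrq, hfirst⟩ := q.exists_isPath_first_mem
    {z | ∃ i, z ∈ (P i).support} ⟨v, ⟨i₀, Walk.end_mem_support _⟩, Walk.end_mem_support _⟩
  have hxu : x ≠ u := by rintro rfl; exact hq (hrq (Walk.end_mem_support _))
  obtain ⟨t, hut, htP⟩ : ∃ t : G.Walk x v, u ∉ t.support ∧ t.support ⊆ (P i).support := by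
    have hPi := hP i
    generalize P i = p at hxi hPi
    cases p with
    | nil => exact absurd (by simpa using hxi) hxu
    | cons h p =>
      have hxp : x ∈ p.support := by simpa [hxu] using hxi
      have hsub := p.support_dropUntil_subset_support hxp
      exact ⟨p.dropUntil x hxp, fun h => ((Walk.cons_isPath_iff _ _).1 hPi).2 (hsub h),
        fun z hz => by simp [hsub hz]⟩
  have hsupp : ∀ z ∈ (r.append t).bypass.support, z ∈ r.support ∨ z ∈ t.support := fun z hz =>
    (Walk.mem_support_append_iff _ _).1 (Walk.support_bypass_subset_support _ hz)
  refine ⟨i, .cons heu (r.append t).bypass, ?_, by simp, fun j hj z hz hzj => ?_⟩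
  · rw [Walk.cons_isPath_iff]
    exact ⟨Walk.bypass_isPath _, fun h => (hsupp u h).elim (fun h => hq (hrq h)) hut⟩
  · rw [Walk.support_cons, List.mem_cons] at hz
    rcases hz with h | hz
    · exact .inl h
    · refine hd i j hj.symm z ?_ hzj
      rcases hsupp z hz with h | h
      · rwa [hfirst z h ⟨j, hzj⟩]
      · exact htP h

end SimpleGraph

theorem stmt_1 {V : Type*} [Fintype V] (G : SimpleGraph V)
    (hG : ThreeConnected G) (u v u' : V) (huv : u ≠ v)
    (heu : G.Adj u u') :
    ∃ P₁ P₂ P₃ : G.Walk u v,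
      P₁.IsPath ∧ P₂.IsPath ∧ P₃.IsPath ∧
      InternallyDisjoint P₁ P₂ ∧ InternallyDisjoint P₁ P₃ ∧
      InternallyDisjoint P₂ P₃ ∧
      (s(u, u') ∈ P₁.edges ∨ s(u, u') ∈ P₂.edges ∨ s(u, u') ∈ P₃.edges) := by
  obtain ⟨q, hq⟩ := hG.exists_walk_avoiding (S := {u}) (a := u') (b := v) (by simp)
    heu.ne' huv.symm
  obtain ⟨P, hP, hd⟩ : ∃ P : Fin 3 → G.Walk u v, (∀ i, (P i).IsPath) ∧
      ∀ i j, i ≠ j → InternallyDisjoint (P i) (P j) := by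
    by_cases hadj : G.Adj u v
    · exact ⟨fun _ => hadj.toWalk, fun _ => by simp [huv], fun _ _ _ z hz _ => by
        simpa using hz⟩
    · exact hG.exists_three_paths huv hadj
  obtain ⟨i, R, hR, he, hRd⟩ := exists_reroute 0 hP hd heu q fun h => hq u h rfl
  obtain ⟨j, k, hj, hk, hjk⟩ : ∃ j k : Fin 3, j ≠ i ∧ k ≠ i ∧ j ≠ k := by
    have : ∀ i : Fin 3, ∃ j k : Fin 3, j ≠ i ∧ k ≠ i ∧ j ≠ k := by decide
    exact this i
  exact ⟨R, P j, P k, hR, hP j, hP k, hRd j hj, hRd k hk, hd j k hjk, .inl he⟩
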